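/- arXiv:1812.11895 — 2 statements merged into one kernel-verified Lean document; each statement's English description precedes it below -/
import Mathlib

section
/- Let G be a graph with at least one edge, let κ, τ be nonnegative integers, and let x̄ be a particular (real) solution of the linear system (A_G − (κ − τ)I_n)x = τ·𝟙 (assuming such a solution exists). Then G has a (κ,τ)-regular set if and only if there is a 0-1 vector x such that x = x̄ + û, where û = 0 if κ − τ is not an eigenvalue of G and û lies in the eigenspace of A_G associated with κ − τ otherwise. Furthermore, every 0-1 vector x of this form is the characteristic vector of a (κ,τ)-regular set of G. -/
open SimpleGraph Matrix

/-- `S` is a `(κ,τ)`-regular set of `G`: every vertex in `S` has exactly `κ` neighbors in `S`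
and every vertex outside `S` has exactly `τ` neighbors in `S`. -/
def IsKTRegular {V : Type*} (G : SimpleGraph V) (S : Set V) (κ τ : ℕ) : Prop :=
  (∀ v ∈ S, (G.neighborSet v ∩ S).ncard = κ) ∧ ∀ v ∉ S, (G.neighborSet v ∩ S).ncard = τ

/-- The characteristic (0-1) vector of a vertex subset. -/
noncomputable def charVec {V : Type*} (S : Set V) : V → ℝ := S.indicator 1

/-- `μ` is an eigenvalue of the real matrix `A`. -/
def IsAdjEigenvalue {n : ℕ} (A : Matrix (Fin n) (Fin n) ℝ) (μ : ℝ) : Prop :=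
  ∃ v : Fin n → ℝ, v ≠ 0 ∧ A.mulVec v = μ • v

theorem adjMatrix_mulVec_charVec_apply {V : Type*} [Fintype V] (G : SimpleGraph V)
    [DecidableRel G.Adj] (S : Set V) (v : V) :
    (G.adjMatrix ℝ *ᵥ charVec S) v = ((G.neighborSet v ∩ S).ncard : ℝ) := by
  classical
  have h : G.neighborSet v ∩ S = ↑((G.neighborFinset v).filter (· ∈ S)) := by
    ext w
    simp
  rw [adjMatrix_mulVec_apply, h, Set.ncard_coe_finset, Finset.card_filter]
  simp [charVec, Set.indicator_apply]

theorem isKTRegular_iff_mulVec_charVec {V : Type*} [Fintype V] (G : SimpleGraph V)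
    [DecidableRel G.Adj] (S : Set V) (κ τ : ℕ) :
    IsKTRegular G S κ τ ↔
      G.adjMatrix ℝ *ᵥ charVec S = ((κ : ℝ) - τ) • charVec S + (τ : ℝ) • (1 : V → ℝ) := by
  rw [funext_iff, IsKTRegular, ← forall_and]
  refine forall_congr' fun v => ?_
  rw [adjMatrix_mulVec_charVec_apply]
  by_cases hv : v ∈ S <;> simp [charVec, hv]

theorem eq_charVec_of_zero_or_one {V : Type*} {x : V → ℝ} (hx : ∀ i, x i = 0 ∨ x i = 1) :
    x = charVec {i | x i = 1} := by
  ext i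
  rcases hx i with h | h <;> simp [charVec, h]

theorem charVec_apply_eq_zero_or_one {V : Type*} (S : Set V) (i : V) :
    charVec S i = 0 ∨ charVec S i = 1 := by
  by_cases h : i ∈ S <;> simp [charVec, h]

/-- Given a particular solution `x̄` of `(A_G - (κ-τ)I)x = τ𝟙`, the graph `G` (with at least
one edge) has a `(κ,τ)`-regular set iff some 0-1 vector `x` is of the form `x = x̄ + û`, where
`û = 0` when `κ - τ` is not an eigenvalue of `G` and `û` is in the eigenspace of `κ - τ`
otherwise; moreover every such 0-1 vector is the characteristic vector of a `(κ,τ)`-regular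
set. -/
theorem kt_regular_iff_particular_solution {n κ τ : ℕ} (G : SimpleGraph (Fin n))
    [DecidableRel G.Adj] (hE : G.edgeSet.Nonempty) (xbar : Fin n → ℝ)
    (hxbar : (G.adjMatrix ℝ - ((κ : ℝ) - τ) • (1 : Matrix (Fin n) (Fin n) ℝ)).mulVec xbar =
      (τ : ℝ) • (1 : Fin n → ℝ)) :
    ((∃ S : Set (Fin n), IsKTRegular G S κ τ) ↔
      ∃ x u : Fin n → ℝ, (∀ i, x i = 0 ∨ x i = 1) ∧ x = xbar + u ∧
        (¬ IsAdjEigenvalue (G.adjMatrix ℝ) ((κ : ℝ) - τ) → u = 0) ∧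
        (IsAdjEigenvalue (G.adjMatrix ℝ) ((κ : ℝ) - τ) →
          (G.adjMatrix ℝ).mulVec u = ((κ : ℝ) - τ) • u)) ∧
    ∀ x u : Fin n → ℝ, (∀ i, x i = 0 ∨ x i = 1) → x = xbar + u →
      (¬ IsAdjEigenvalue (G.adjMatrix ℝ) ((κ : ℝ) - τ) → u = 0) →
      (IsAdjEigenvalue (G.adjMatrix ℝ) ((κ : ℝ) - τ) →
        (G.adjMatrix ℝ).mulVec u = ((κ : ℝ) - τ) • u) →
      ∃ S : Set (Fin n), IsKTRegular G S κ τ ∧ x = charVec S := by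
  have hA : G.adjMatrix ℝ *ᵥ xbar = ((κ : ℝ) - τ) • xbar + (τ : ℝ) • (1 : Fin n → ℝ) := by
    rw [← hxbar, sub_mulVec, smul_mulVec, one_mulVec]
    abel
  have hchar : ∀ x u : Fin n → ℝ, (∀ i, x i = 0 ∨ x i = 1) → x = xbar + u →
      (¬ IsAdjEigenvalue (G.adjMatrix ℝ) ((κ : ℝ) - τ) → u = 0) →
      (IsAdjEigenvalue (G.adjMatrix ℝ) ((κ : ℝ) - τ) →
        (G.adjMatrix ℝ).mulVec u = ((κ : ℝ) - τ) • u) →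
      ∃ S : Set (Fin n), IsKTRegular G S κ τ ∧ x = charVec S := by
    intro x u hx hxu h0 h1
    have hu : G.adjMatrix ℝ *ᵥ u = ((κ : ℝ) - τ) • u := by
      by_cases h : IsAdjEigenvalue (G.adjMatrix ℝ) ((κ : ℝ) - τ)
      · exact h1 h
      · simp [h0 h]
    refine ⟨_, (isKTRegular_iff_mulVec_charVec G _ κ τ).2 ?_, eq_charVec_of_zero_or_one hx⟩
    rw [← eq_charVec_of_zero_or_one hx, hxu, mulVec_add, hA, hu, smul_add]
    abel
  refine ⟨⟨?_, ?_⟩, hchar⟩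
  · rintro ⟨S, hS⟩
    have hu : G.adjMatrix ℝ *ᵥ (charVec S - xbar) = ((κ : ℝ) - τ) • (charVec S - xbar) := by
      rw [mulVec_sub, (isKTRegular_iff_mulVec_charVec G S κ τ).1 hS, hA, smul_sub]
      abel
    refine ⟨charVec S, charVec S - xbar, charVec_apply_eq_zero_or_one S,
      (add_sub_cancel _ _).symm, fun h => ?_, fun _ => hu⟩
    by_contra hne
    exact h ⟨_, hne, hu⟩
  · rintro ⟨x, u, hx, hxu, h0, h1⟩
    obtain ⟨S, hS, -⟩ := hchar x u hx hxu h0 h1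
    exact ⟨S, hS⟩
end

section
/- Let G be a graph of order n with a (κ,τ)-regular set S which is a proper subset of V(G), let x̄ be a particular solution of the linear system (A_G − (κ − τ)I_n)x = τ·𝟙, and suppose κ − τ is an eigenvalue of G with multiplicity t. Let v̂₁, …, v̂_t be eigenvectors of A_G associated with κ − τ and let I = {i₁, …, i_t} ⊆ V(G) be a set of t indices such that the t×t submatrix of the matrix with columns v̂₁, …, v̂_t formed by the rows indexed by I is the identity matrix. Then the characteristic vector x of S satisfies x = x̄ + Σ_{j=1}^{t} δ_{i_j} v̂_j, where each scalar δ_{i_j} belongs to {−x̄_{i_j}, 1 − x̄_{i_j}}. -/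
open SimpleGraph Matrix

/-- The eigenspace of the real matrix `A` associated with `μ`. -/
noncomputable def eigSpace {n : ℕ} (A : Matrix (Fin n) (Fin n) ℝ) (μ : ℝ) :
    Submodule ℝ (Fin n → ℝ) :=
  Module.End.eigenspace (Matrix.toLin' A) μ

theorem adjMatrix_mulVec_charVec {V : Type*} [Fintype V] (G : SimpleGraph V)
    [DecidableRel G.Adj] (S : Set V) (i : V) :
    (G.adjMatrix ℝ).mulVec (charVec S) i = ((G.neighborSet i ∩ S).ncard : ℝ) := by
  classical
  have h : G.neighborSet i ∩ S = ↑((G.neighborFinset i).filter (· ∈ S)) := by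
    ext; simp
  rw [adjMatrix_mulVec_apply, h, Set.ncard_coe_finset]
  simp [charVec, Set.indicator_apply]

theorem IsKTRegular.adjMatrix_mulVec_charVec {V : Type*} [Fintype V] {G : SimpleGraph V}
    [DecidableRel G.Adj] {S : Set V} {κ τ : ℕ} (hS : IsKTRegular G S κ τ) :
    (G.adjMatrix ℝ).mulVec (charVec S) =
      ((κ : ℝ) - τ) • charVec S + (τ : ℝ) • (1 : V → ℝ) := by
  ext i
  rw [_root_.adjMatrix_mulVec_charVec]
  by_cases hi : i ∈ S
  · simp [hS.1 i hi, charVec, hi]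
  · simp [hS.2 i hi, charVec, hi]

/-- A family of as many vectors as the dimension of a subspace of `ι → K`, which restricts to the
identity on some coordinates, gives an expansion of each vector of the subspace whose coefficients
are those coordinates. -/
theorem eq_sum_smul_of_apply_eq_ite {K ι : Type*} [Field K] [Fintype ι] {t : ℕ}
    {E : Submodule K (ι → K)} (hE : Module.finrank K E = t) {v : Fin t → ι → K}
    (hv : ∀ j, v j ∈ E) {idx : Fin t → ι}
    (hid : ∀ j k, v k (idx j) = if j = k then 1 else 0) {w : ι → K} (hw : w ∈ E) :
    w = ∑ j, w (idx j) • v j := by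
  have coord (c : Fin t → K) (j : Fin t) : (∑ k, c k • v k) (idx j) = c j := by
    simp [hid]
  have hli : LinearIndependent K v := by
    rw [Fintype.linearIndependent_iff]
    intro c hc j
    rw [← coord c j, hc, Pi.zero_apply]
  have hspan : Submodule.span K (Set.range v) = E := by
    refine Submodule.eq_of_le_of_finrank_eq (Submodule.span_le.2 ?_) ?_
    · rintro _ ⟨j, rfl⟩
      exact hv j
    · rw [finrank_span_eq_card hli, hE, Fintype.card_fin]
  rw [← hspan, Submodule.mem_span_range_iff_exists_fun] at hw
  obtain ⟨c, rfl⟩ := hw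
  simp only [coord]

/-- If `S` is a proper `(κ,τ)`-regular set of `G`, `x̄` a particular solution of
`(A_G - (κ-τ)I)x = τ𝟙`, `κ-τ` an eigenvalue of multiplicity `t`, and `v̂₁,…,v̂_t` are
eigenvectors for `κ-τ` whose matrix of columns contains a `t × t` identity submatrix in the
rows indexed by `i₁,…,i_t`, then the characteristic vector of `S` is
`x̄ + Σ_j δ_{i_j} v̂_j` where each `δ_{i_j} ∈ {-x̄_{i_j}, 1 - x̄_{i_j}}`. -/
theorem kt_regular_char_vec_decomposition {n κ τ t : ℕ} (G : SimpleGraph (Fin n))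
    [DecidableRel G.Adj] (S : Set (Fin n)) (hSproper : S ⊂ Set.univ)
    (hS : IsKTRegular G S κ τ) (xbar : Fin n → ℝ)
    (hxbar : (G.adjMatrix ℝ - ((κ : ℝ) - τ) • (1 : Matrix (Fin n) (Fin n) ℝ)).mulVec xbar =
      (τ : ℝ) • (1 : Fin n → ℝ))
    (heig : IsAdjEigenvalue (G.adjMatrix ℝ) ((κ : ℝ) - τ))
    (hmult : Module.finrank ℝ (eigSpace (G.adjMatrix ℝ) ((κ : ℝ) - τ)) = t)
    (v : Fin t → (Fin n → ℝ))
    (hv : ∀ j, (G.adjMatrix ℝ).mulVec (v j) = ((κ : ℝ) - τ) • (v j))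
    (idx : Fin t → Fin n) (hinj : Function.Injective idx)
    (hid : ∀ j k : Fin t, v k (idx j) = if j = k then 1 else 0) :
    ∃ δ : Fin t → ℝ, (∀ j, δ j = -(xbar (idx j)) ∨ δ j = 1 - xbar (idx j)) ∧
      charVec S = xbar + ∑ j, δ j • v j := by
  have hw : charVec S - xbar ∈ eigSpace (G.adjMatrix ℝ) ((κ : ℝ) - τ) := by
    rw [sub_mulVec, smul_mulVec, one_mulVec, sub_eq_iff_eq_add] at hxbar
    rw [eigSpace, Module.End.mem_eigenspace_iff, toLin'_apply, mulVec_sub,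
      hS.adjMatrix_mulVec_charVec, hxbar, smul_sub]
    abel
  have hvE (j : Fin t) : v j ∈ eigSpace (G.adjMatrix ℝ) ((κ : ℝ) - τ) := by
    rw [eigSpace, Module.End.mem_eigenspace_iff, toLin'_apply, hv]
  refine ⟨fun j ↦ (charVec S - xbar) (idx j), fun j ↦ ?_, ?_⟩
  · by_cases hj : idx j ∈ S <;> simp [charVec, hj]
  · rw [← eq_sum_smul_of_apply_eq_ite hmult hvE hid hw, add_sub_cancel]
end
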